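/- arXiv:1706.09983 — 2 statements merged into one kernel-verified Lean document; each statement's English description precedes it below -/
import Mathlib

section
/- Let f : X → Y be a proper morphism of S-schemes, let i : Z ↪ P be a compactification of x : X → S with complementary open immersion j_i : X ↪ P, and let l : W ↪ Q be a compactification of y : Y → S with complementary open immersion j_l : Y ↪ Q. Then there exist a compactification i' : Z' ↪ P' of x, with complementary open immersion j_{i'} : X ↪ P', and morphisms of compactifications (h, h') : i' → i and (g, g') : i' → l such that the identity morphism of X is the base change of h' : P' → P along j_i and f is the base change of g' : P' → Q along j_l. -/
open CategoryTheory AlgebraicGeometry CategoryTheory.Limits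

/-- A compactification of an `S`-scheme `X` (an object of `Over S`): a closed immersion
`i : Z ↪ P` of proper `S`-schemes together with a complementary open immersion `j : X ↪ P`,
i.e. the set-theoretic image of `j` is the complement of the set-theoretic image of `i`. -/
structure Compactification {S : Scheme.{0}} (X : Over S) where
  /-- the boundary -/
  Z : Over S
  /-- the ambient proper `S`-scheme -/
  P : Over S
  properZ : IsProper Z.hom
  properP : IsProper P.hom
  /-- the closed immersion `Z ↪ P` -/
  i : Z ⟶ P
  closed_i : IsClosedImmersion i.left
  /-- the complementary open immersion `X ↪ P` -/
  j : X ⟶ P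
  open_j : IsOpenImmersion j.left
  compl : Set.range j.left.base = (Set.range i.left.base)ᶜ

/-- A morphism of compactifications `(f, g) : i → l`: morphisms `f : Z ⟶ W` and `g : P ⟶ Q`
of `S`-schemes such that `g ∘ i = l ∘ f` and the induced morphism `Z → W ×_Q P` to the fibre
product is surjective. -/
structure CompMor {S : Scheme.{0}} {X Y : Over S} (C : Compactification X)
    (D : Compactification Y) where
  /-- the morphism on boundaries -/
  f : C.Z ⟶ D.Z
  /-- the morphism on ambient schemes -/
  g : C.P ⟶ D.P
  comm : C.i.left ≫ g.left = f.left ≫ D.i.left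
  surj : Function.Surjective (pullback.lift f.left C.i.left comm.symm).base

/-- `h : X ⟶ Y` is the base change of `g : C.P ⟶ D.P` along `j_l = D.j`: the square with top
arrow `C.j : X ↪ C.P`, bottom arrow `D.j : Y ↪ D.P`, left arrow `h` and right arrow `g`
commutes and is Cartesian. -/
def IsBaseChangeOf {S : Scheme.{0}} {X Y : Over S} (C : Compactification X)
    (D : Compactification Y) (g : C.P ⟶ D.P) (h : X ⟶ Y) : Prop :=
  IsPullback C.j.left h.left g.left D.j.left

namespace AlgebraicGeometry

instance isSchemeTheoreticallyDominant_toImage {X Y : Scheme} (f : X ⟶ Y) :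
    IsSchemeTheoreticallyDominant f.toImage where
  ker_eq_bot := by
    rw [← Scheme.isIso_subschemeι_iff_eq_bot]
    refine IsClosedImmersion.isIso_of_ker_eq (f.toImage.ker.subschemeι ≫ f.imageι) f.imageι _ rfl ?_
    refine le_antisymm ?_ (Scheme.Hom.le_ker_comp _ _)
    have hf : f.toImage.toImage ≫ f.toImage.imageι ≫ f.imageι = f := by simp
    calc
      _ ≤ (f.toImage.toImage ≫ f.toImage.imageι ≫ f.imageι).ker := Scheme.Hom.le_ker_comp _ _
      _ = f.imageι.ker := by rw [hf, Scheme.IdealSheafData.ker_subschemeι]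

variable {X Y P Q : Scheme} {t : X ⟶ P} {h : X ⟶ Y} {g : P ⟶ Q} {j : Y ⟶ Q}

/-- A scheme-theoretically dominant morphism into `P` remains so as a morphism into an open
subscheme of `P` through which it factors. -/
lemma isSchemeTheoreticallyDominant_pullback_lift [IsSchemeTheoreticallyDominant t]
    [QuasiCompact t] [IsOpenImmersion j] (w : t ≫ g = h ≫ j) :
    IsSchemeTheoreticallyDominant (pullback.lift t h w) := by
  have H : IsPullback (𝟙 X) (pullback.lift t h w) t (pullback.fst g j) :=
    ⟨⟨by rw [pullback.lift_fst, Category.id_comp]⟩, ⟨PullbackCone.IsLimit.mk _ (fun s ↦ s.fst) (fun s ↦ by simp)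
      (fun s ↦ by
        rw [← cancel_mono (pullback.fst g j), Category.assoc, pullback.lift_fst, s.condition])
      (fun s m h₁ _ ↦ by simpa using h₁)⟩⟩
  exact .of_isPullback H

lemma isPullback_of_isIso_lift (w : t ≫ g = h ≫ j) [IsIso (pullback.lift t h w)] :
    IsPullback t h g j :=
  .of_iso_pullback ⟨w⟩ (asIso (pullback.lift t h w))
    (pullback.lift_fst _ _ _) (pullback.lift_snd _ _ _)

lemma isPullback_id_of_isSchemeTheoreticallyDominant [IsSchemeTheoreticallyDominant t]
    [QuasiCompact t] {j : X ⟶ Q} [IsOpenImmersion j] [IsSeparated g] (w : t ≫ g = 𝟙 X ≫ j) :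
    IsPullback t (𝟙 X) g j := by
  have := isSchemeTheoreticallyDominant_pullback_lift w
  have : IsClosedImmersion (pullback.lift t (𝟙 X) w ≫ pullback.snd g j) := by
    rw [pullback.lift_snd]; infer_instance
  have : IsClosedImmersion (pullback.lift t (𝟙 X) w) := .of_comp _ (pullback.snd g j)
  have : IsIso (pullback.lift t (𝟙 X) w) :=
    IsClosedImmersion.isIso_iff_ker_eq_bot.mpr (Scheme.Hom.ker_eq_bot _)
  exact isPullback_of_isIso_lift w

lemma isPullback_of_isProper_of_isOpenImmersion [IsSchemeTheoreticallyDominant t]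
    [QuasiCompact t] [IsOpenImmersion t] [IsOpenImmersion j] [IsSeparated g] [IsProper h]
    (w : t ≫ g = h ≫ j) : IsPullback t h g j := by
  have := isSchemeTheoreticallyDominant_pullback_lift w
  have : IsProper (pullback.lift t h w ≫ pullback.snd g j) := by
    rwa [pullback.lift_snd]
  have : IsProper (pullback.lift t h w) := .of_comp _ (pullback.snd g j)
  have : IsOpenImmersion (pullback.lift t h w ≫ pullback.fst g j) := by
    rwa [pullback.lift_fst]
  have : IsOpenImmersion (pullback.lift t h w) := .of_comp _ (pullback.fst g j)
  have : Surjective (pullback.lift t h w) := by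
    refine ⟨Set.range_eq_univ.mp ?_⟩
    rw [← (pullback.lift t h w).isClosedMap.isClosed_range.closure_eq]
    exact (pullback.lift t h w).denseRange.closure_eq
  have : IsIso (pullback.lift t h w) :=
    (isIso_iff_isOpenImmersion_and_surjective _).mpr ⟨inferInstance, inferInstance⟩
  exact isPullback_of_isIso_lift w

lemma surjective_of_comp_of_range_subset {A B P : Scheme} (s : A ⟶ B) (b : B ⟶ P)
    (hb : Function.Injective b) (hs : Set.range b ⊆ Set.range (s ≫ b)) :
    Function.Surjective s := by
  intro x
  obtain ⟨a, ha⟩ := hs ⟨x, rfl⟩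
  exact ⟨a, hb (by simpa using ha)⟩

/-- In a Cartesian square, the range of the first projection is the preimage of the range of the
opposite side. -/
lemma range_eq_preimage_of_isPullback (H : IsPullback t h g j) :
    Set.range t = g ⁻¹' Set.range j := by
  rw [← Scheme.Pullback.range_fst, ← H.isoPullback_hom_fst, Scheme.Hom.comp_base, TopCat.coe_comp,
    (H.isoPullback.hom.surjective).range_comp]

end AlgebraicGeometry

namespace Compactification

variable {S : Scheme.{0}} {X Y : Over S}

lemma range_i_eq_compl (C : Compactification X) :
    Set.range C.i.left = (Set.range C.j.left)ᶜ :=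
  (compl_eq_comm.mp C.compl.symm).symm

/-- For a base change of the open parts, the surjectivity condition on a morphism of
compactifications is automatic. -/
lemma surjective_lift_of_isBaseChangeOf {C : Compactification X} {D : Compactification Y}
    {h : X ⟶ Y} {g : C.P ⟶ D.P} (H : IsBaseChangeOf C D g h) (f : C.Z ⟶ D.Z)
    (comm : C.i.left ≫ g.left = f.left ≫ D.i.left) :
    Function.Surjective (pullback.lift f.left C.i.left comm.symm).base := by
  have := D.closed_i
  refine surjective_of_comp_of_range_subset _ (pullback.snd D.i.left g.left)
    (pullback.snd D.i.left g.left).isClosedEmbedding.injective ?_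
  rw [pullback.lift_snd, Scheme.Pullback.range_snd, C.range_i_eq_compl,
    D.range_i_eq_compl, range_eq_preimage_of_isPullback H, Set.preimage_compl]

/-- A proper `S`-scheme containing `X` as an open subscheme, and mapping to the ambient schemes of
`C` and `D` so that `𝟙 X` and `f` are the base changes to `X` and `Y`, underlies a compactification
of `X` mapping to `C` and `D`. -/
lemma exists_compMor_of_isPullback (C : Compactification X) (D : Compactification Y) (f : X ⟶ Y)
    {P : Over S} [IsProper P.hom] (j : X ⟶ P) [IsOpenImmersion j.left] (p : P ⟶ C.P) (q : P ⟶ D.P)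
    (hC : IsPullback j.left (𝟙 X.left) p.left C.j.left)
    (hD : IsPullback j.left f.left q.left D.j.left) :
    ∃ (C' : Compactification X) (h : CompMor C' C) (g : CompMor C' D),
      IsBaseChangeOf C' C h.g (𝟙 X) ∧ IsBaseChangeOf C' D g.g f := by
  have := C.closed_i
  have := D.closed_i
  let a := pullback.fst p.left C.i.left
  let b := pullback.fst q.left D.i.left
  let c : pullback a b ⟶ P.left := pullback.fst a b ≫ a
  have hcb : c = pullback.snd a b ≫ b := pullback.condition
  have hcp : c ≫ p.left = (pullback.fst a b ≫ pullback.snd p.left C.i.left) ≫ C.i.left := by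
    rw [Category.assoc, Category.assoc, pullback.condition]
  have hcq : c ≫ q.left = (pullback.snd a b ≫ pullback.snd q.left D.i.left) ≫ D.i.left := by
    rw [hcb, Category.assoc, Category.assoc, pullback.condition]
  have hc : IsClosedImmersion c := inferInstance
  let i : Over.mk (c ≫ P.hom) ⟶ P := Over.homMk c rfl
  let C' : Compactification X :=
    { Z := Over.mk (c ≫ P.hom)
      P := P
      properZ := inferInstanceAs (IsProper (c ≫ P.hom))
      properP := inferInstance
      i := i
      closed_i := hc
      j := j
      open_j := inferInstance
      compl := by
        change Set.range j.left = (Set.range c)ᶜ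
        have hc : Set.range c = Set.range a ∩ Set.range b := Scheme.Pullback.range_fst_comp a b
        rw [hc, Scheme.Pullback.range_fst, Scheme.Pullback.range_fst, C.range_i_eq_compl,
          D.range_i_eq_compl, Set.preimage_compl, Set.preimage_compl,
          ← range_eq_preimage_of_isPullback hC, ← range_eq_preimage_of_isPullback hD,
          Set.inter_self, compl_compl] }
  have HC : IsBaseChangeOf C' C p (𝟙 X) := hC
  have HD : IsBaseChangeOf C' D q f := hD
  let fC : C'.Z ⟶ C.Z := Over.homMk (pullback.fst a b ≫ pullback.snd p.left C.i.left) (by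
    rw [← Over.w C.i, ← Category.assoc, ← hcp, Category.assoc, Over.w p]; rfl)
  let fD : C'.Z ⟶ D.Z := Over.homMk (pullback.snd a b ≫ pullback.snd q.left D.i.left) (by
    rw [← Over.w D.i, ← Category.assoc, ← hcq, Category.assoc, Over.w q]; rfl)
  exact ⟨C', ⟨fC, p, hcp, surjective_lift_of_isBaseChangeOf HC fC hcp⟩,
    ⟨fD, q, hcq, surjective_lift_of_isBaseChangeOf HD fD hcq⟩, HC, HD⟩

end Compactification

theorem statement1
    (S : Scheme.{0}) [IsNoetherian S] [S.IsSeparated]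
    (X Y : Over S)
    [IsNoetherian X.left] [IsNoetherian Y.left] [X.left.IsSeparated] [Y.left.IsSeparated]
    [LocallyOfFiniteType X.hom] [QuasiCompact X.hom]
    [LocallyOfFiniteType Y.hom] [QuasiCompact Y.hom]
    (f : X ⟶ Y) (hf : IsProper f.left)
    (C : Compactification X) (D : Compactification Y) :
    ∃ (C' : Compactification X) (h : CompMor C' C) (g : CompMor C' D),
      IsBaseChangeOf C' C h.g (𝟙 X) ∧ IsBaseChangeOf C' D g.g f := by
  have := C.properP
  have := D.properP
  have := C.open_j
  have := D.open_j
  let u : X.left ⟶ pullback C.P.hom D.P.hom :=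
    pullback.lift C.j.left (f.left ≫ D.j.left) (by simp)
  let p : u.image ⟶ C.P.left := u.imageι ≫ pullback.fst _ _
  let q : u.image ⟶ D.P.left := u.imageι ≫ pullback.snd _ _
  have hpq : q ≫ D.P.hom = p ≫ C.P.hom := by
    rw [Category.assoc, Category.assoc, pullback.condition]
  have hp : u.toImage ≫ p = 𝟙 X.left ≫ C.j.left := by
    rw [Scheme.Hom.toImage_imageι_assoc, pullback.lift_fst, Category.id_comp]
  have hq : u.toImage ≫ q = f.left ≫ D.j.left := by
    rw [Scheme.Hom.toImage_imageι_assoc, pullback.lift_snd]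
  have hC : IsPullback u.toImage (𝟙 X.left) p C.j.left :=
    isPullback_id_of_isSchemeTheoreticallyDominant hp
  have : IsOpenImmersion u.toImage := MorphismProperty.of_isPullback hC.flip C.open_j
  have hD : IsPullback u.toImage f.left q D.j.left :=
    isPullback_of_isProper_of_isOpenImmersion hq
  have : IsProper (Over.mk (p ≫ C.P.hom)).hom := inferInstanceAs (IsProper (p ≫ C.P.hom))
  let j : X ⟶ Over.mk (p ≫ C.P.hom) := Over.homMk u.toImage (by
    change u.toImage ≫ p ≫ C.P.hom = X.hom
    rw [reassoc_of% hp, Over.w])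
  have : IsOpenImmersion j.left := ‹IsOpenImmersion u.toImage›
  exact C.exists_compMor_of_isPullback D f j (Over.homMk p rfl) (Over.homMk q hpq) hC hD
end

section
/- Let j : S ↪ T be an open immersion of Noetherian separated schemes, let q : Q → T be a proper T-scheme, and let Q' = Q ×_T S, regarded as a proper S-scheme (it is an open subscheme of Q). For every cdp-covering family (respectively, proper covering family) {σ_α : P_α → Q'}_{α∈A} of proper S-schemes over Q', there exists a cdp-covering family (respectively, proper covering family) {δ_β : V_β → Q}_{β∈B} of proper T-schemes over Q such that, for every β ∈ B, either the base change V_β ×_Q Q' → Q' of δ_β factors through σ_α for some α ∈ A, or the scheme V_β ×_Q Q' is empty. -/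
/-!
STATEMENT 15: Let `j : S ↪ T` be an open immersion of Noetherian separated schemes, let
`q : Q ⟶ T` be a proper `T`-scheme, and let `Q' = Q ×_T S` (an open subscheme of `Q`),
regarded as a proper `S`-scheme.  For every cdp-covering (resp. proper covering) family
`{σ_α : P_α ⟶ Q'}_{α ∈ A}` of proper `S`-schemes over `Q'`, there exists a cdp-covering
(resp. proper covering) family `{δ_β : V_β ⟶ Q}_{β ∈ B}` of proper `T`-schemes over `Q`
such that for every `β` either the base change `V_β ×_Q Q' ⟶ Q'` of `δ_β` factors through
some `σ_α`, or `V_β ×_Q Q'` is empty.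
-/

open CategoryTheory AlgebraicGeometry CategoryTheory.Limits

/-- There is a proper scheme over `ℤ` with an affine open chart whose coordinate ring maps to any
ring with a prescribed finite family of elements in the image. -/
theorem exists_isProper_terminal_affineChart (n : Type) [Finite n] :
    ∃ (X : Scheme.{0}) (A : CommRingCat.{0}) (c : Spec A ⟶ X),
      IsOpenImmersion c ∧ IsProper (terminal.from X) ∧
      ∀ (B : CommRingCat.{0}) (b : n → B), ∃ φ : A ⟶ B, ∀ i, b i ∈ φ.hom.range := by
  let 𝒜 : ℕ → Submodule ℤ (MvPolynomial (Option n) ℤ) :=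
    MvPolynomial.homogeneousSubmodule (Option n) ℤ
  let : GradedAlgebra 𝒜 := MvPolynomial.gradedAlgebra
  let x : Option n → MvPolynomial (Option n) ℤ := MvPolynomial.X
  have hx (i) : x i ∈ 𝒜 1 := MvPolynomial.isHomogeneous_X _ _
  let R₀ := algebraMap ℤ (𝒜 0)
  have hR₀ : Function.Surjective R₀ := by
    rintro ⟨p, hp⟩
    have := MvPolynomial.totalDegree_eq_zero_iff_eq_C.mp
      ((MvPolynomial.totalDegree_zero_iff_isHomogeneous _).mpr hp)
    exact ⟨p.coeff 0, Subtype.ext this.symm⟩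
  have : Algebra.FiniteType (𝒜 0) (MvPolynomial (Option n) ℤ) := by
    rw [← RingHom.finiteType_algebraMap]
    refine RingHom.FiniteType.of_comp_finiteType (f := R₀) ?_
    rw [RingHom.ext_int (RingHom.comp _ R₀) (algebraMap ℤ _), RingHom.finiteType_algebraMap]
    infer_instance
  refine ⟨Proj 𝒜, _, Proj.awayι 𝒜 (x none) (hx none) one_pos, inferInstance, ?_, ?_⟩
  · have := IsClosedImmersion.spec_of_surjective (CommRingCat.ofHom R₀) hR₀
    have h : IsProper (Proj.toSpecZero 𝒜 ≫ Spec.map (CommRingCat.ofHom R₀)) := inferInstance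
    have := isIso_of_isTerminal specZIsTerminal terminalIsTerminal (terminal.from _)
    rw [← terminal.comp_from (Proj.toSpecZero 𝒜 ≫ Spec.map (CommRingCat.ofHom R₀))]
    infer_instance
  · intro B b
    let f : MvPolynomial (Option n) ℤ →+* B :=
      MvPolynomial.eval₂Hom (Int.castRingHom B) (fun i ↦ i.elim 1 b)
    have hf : IsUnit (f (x none)) := by simp [f, x]
    let F := IsLocalization.Away.lift (S := Localization.Away (x none)) (x none) hf
    refine ⟨CommRingCat.ofHom
      (F.comp (algebraMap (HomogeneousLocalization.Away 𝒜 (x none)) _)), fun i ↦ ?_⟩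
    refine ⟨HomogeneousLocalization.Away.mk 𝒜 (hx none) 1 (x (some i)) (by simpa using hx _), ?_⟩
    simp only [CommRingCat.hom_ofHom, RingHom.comp_apply, HomogeneousLocalization.algebraMap_apply,
      HomogeneousLocalization.Away.val_mk]
    rw [Localization.mk_eq_mk']
    exact (IsLocalization.lift_mk'_spec ..).mpr (by simp [f, x])

/-- Compactification of a morphism of finite type from an affine scheme to an affine open. -/
theorem exists_isOpenImmersion_isProper_of_isAffine {U Q : Scheme.{0}} [IsAffine U]
    [IsNoetherian U] (g : U ⟶ Q) [LocallyOfFiniteType g] {W : Q.Opens} (hW : IsAffineOpen W)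
    (hg : Set.range g ⊆ W) :
    ∃ (Y : Scheme.{0}) (e : U ⟶ Y) (y : Y ⟶ Q), IsOpenImmersion e ∧ IsProper y ∧ e ≫ y = g := by
  have : IsAffine W := hW
  let h : U ⟶ W := IsOpenImmersion.lift W.ι g (by simpa using hg)
  have hh : h ≫ W.ι = g := IsOpenImmersion.lift_fac ..
  have : LocallyOfFiniteType (h ≫ W.ι) := hh ▸ inferInstance
  have : LocallyOfFiniteType h := locallyOfFiniteType_of_comp h W.ι
  have hft : h.appTop.hom.FiniteType :=
    (HasRingHomProperty.iff_of_isAffine (P := @LocallyOfFiniteType)).mp this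
  algebraize [h.appTop.hom]
  obtain ⟨t, ht⟩ := Algebra.FiniteType.out (R := Γ(W, ⊤)) (A := Γ(U, ⊤))
  obtain ⟨X, A, c, _, _, hA⟩ := exists_isProper_terminal_affineChart t
  obtain ⟨φ, hφ⟩ := hA Γ(U, ⊤) (↑)
  let m : U ⟶ Spec A := U.toSpecΓ ≫ Spec.map φ
  have hm : m.appTop = (Scheme.ΓSpecIso A).hom ≫ φ := by simp [m]
  let l : U ⟶ pullback (terminal.from W.toScheme) (terminal.from (Spec A)) :=
    pullback.lift h m (Subsingleton.elim _ _)
  have hfst : (pullback.fst (terminal.from W.toScheme) (terminal.from (Spec A))).appTop ≫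
      l.appTop = h.appTop := by
    rw [← Scheme.Hom.comp_appTop, pullback.lift_fst]
  have hsnd : (pullback.snd (terminal.from W.toScheme) (terminal.from (Spec A))).appTop ≫
      l.appTop = m.appTop := by
    rw [← Scheme.Hom.comp_appTop, pullback.lift_snd]
  have : IsClosedImmersion l := by
    apply IsClosedImmersion.of_surjective_of_isAffine
    intro b
    have hb : b ∈ Algebra.adjoin Γ(W, ⊤) (t : Set Γ(U, ⊤)) := ht ▸ Algebra.mem_top
    change b ∈ l.appTop.hom.range
    induction hb using Algebra.adjoin_induction with
    | mem b hb =>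
      obtain ⟨a, ha⟩ := hφ ⟨b, hb⟩
      refine ⟨(pullback.snd (terminal.from W.toScheme) (terminal.from (Spec A))).appTop
        ((Scheme.ΓSpecIso A).inv a), ?_⟩
      simpa [hm, ha] using congr($hsnd ((Scheme.ΓSpecIso A).inv a))
    | algebraMap r =>
      exact ⟨(pullback.fst (terminal.from W.toScheme) (terminal.from (Spec A))).appTop r,
        congr($hfst r)⟩
    | add _ _ _ _ h₁ h₂ => exact add_mem h₁ h₂
    | mul _ _ _ _ h₁ h₂ => exact mul_mem h₁ h₂
  let w : pullback (terminal.from W.toScheme) (terminal.from (Spec A)) ⟶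
      pullback (terminal.from Q) (terminal.from X) :=
    pullback.map _ _ _ _ W.ι c (𝟙 _) (Subsingleton.elim _ _) (Subsingleton.elim _ _)
  refine ⟨_, (l ≫ w).toImage, (l ≫ w).imageι ≫ pullback.fst _ _, inferInstance, inferInstance, ?_⟩
  rw [Scheme.Hom.toImage_imageι_assoc, Category.assoc, pullback.lift_fst, pullback.lift_fst_assoc, hh]

/-- Finite fibre products of proper schemes over a base are proper. -/
theorem exists_isProper_lift_of_finite {n : Type} [Finite n] {Q : Scheme.{0}}
    (Y : n → Scheme.{0}) (y : ∀ i, Y i ⟶ Q) (hy : ∀ i, IsProper (y i)) :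
    ∃ (Z : Scheme.{0}) (z : Z ⟶ Q) (π : ∀ i, Z ⟶ Y i), IsProper z ∧ (∀ i, π i ≫ y i = z) ∧
      ∀ (T : Scheme.{0}) (t : T ⟶ Q) (s : ∀ i, T ⟶ Y i), (∀ i, s i ≫ y i = t) →
        ∃ l : T ⟶ Z, l ≫ z = t ∧ ∀ i, l ≫ π i = s i := by
  induction n using Finite.induction_empty_option with
  | of_equiv e ih =>
    obtain ⟨Z, z, π, hz, hπ, H⟩ := ih (fun i ↦ Y (e i)) (fun i ↦ y (e i)) (fun i ↦ hy (e i))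
    have key (i) : ∃ p : Z ⟶ Y i, p ≫ y i = z ∧ ∀ (T : Scheme.{0}) (s : ∀ i, T ⟶ Y i) (l : T ⟶ Z),
        (∀ i, l ≫ π i = s (e i)) → l ≫ p = s i := by
      obtain ⟨i, rfl⟩ := e.surjective i
      exact ⟨π i, hπ i, fun T s l h ↦ h i⟩
    choose p hp hp' using key
    refine ⟨Z, z, p, hz, hp, fun T t s hs ↦ ?_⟩
    obtain ⟨l, hl, hl'⟩ := H T t (fun i ↦ s (e i)) (fun i ↦ hs (e i))
    exact ⟨l, hl, fun i ↦ hp' i T s l hl'⟩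
  | h_empty => exact ⟨Q, 𝟙 Q, nofun, inferInstance, nofun, fun T t s hs ↦ ⟨t, by simp, nofun⟩⟩
  | h_option ih =>
    obtain ⟨Z, z, π, hz, hπ, H⟩ := ih (fun i ↦ Y (some i)) (fun i ↦ y (some i))
      (fun i ↦ hy (some i))
    have := hy none
    refine ⟨pullback z (y none), pullback.fst _ _ ≫ z,
      fun i ↦ i.rec (pullback.snd _ _) (fun i ↦ pullback.fst _ _ ≫ π i), inferInstance, ?_, ?_⟩
    · rintro (_ | i)
      · exact pullback.condition.symm
      · exact (Category.assoc ..).trans (congr($rfl ≫ $(hπ i)))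
    · intro T t s hs
      obtain ⟨l, hl, hl'⟩ := H T t (fun i ↦ s (some i)) (fun i ↦ hs (some i))
      refine ⟨pullback.lift l (s none) (hl.trans (hs none).symm),
        by rw [pullback.lift_fst_assoc, hl], ?_⟩
      rintro (_ | i)
      · exact pullback.lift_snd ..
      · exact (pullback.lift_fst_assoc ..).trans (hl' i)

theorem isReduced_image {X Y : Scheme.{0}} (f : X ⟶ Y) [QuasiCompact f] [IsReduced X] :
    IsReduced f.image := by
  have : IsSchemeTheoreticallyDominant f.toImage := by
    rw [isSchemeTheoreticallyDominant_iff]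
    have hU : ⨆ U : Y.affineOpens, f.imageι ⁻¹ᵁ U.1 = ⊤ := by
      rw [← f.imageι.preimage_iSup, iSup_affineOpens_eq_top, Scheme.Hom.preimage_top]
    refine Scheme.IdealSheafData.ext_of_iSup_eq_top
      (fun U : Y.affineOpens ↦ ⟨f.imageι ⁻¹ᵁ U.1, U.2.preimage f.imageι⟩) hU fun U ↦ ?_
    rw [Scheme.Hom.ker_apply, (RingHom.injective_iff_ker_eq_bot _).mp (f.toImage_app_injective U)]
    rfl
  exact IsSchemeTheoreticallyDominant.isReduced f.toImage

theorem isIntegral_image {X Y : Scheme.{0}} (f : X ⟶ Y) [QuasiCompact f] [IsIntegral X] :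
    IsIntegral f.image := by
  have := isReduced_image f
  have : PreirreducibleSpace f.image := by
    have h := ((PreirreducibleSpace.isPreirreducible_univ (X := X)).image _
        f.toImage.continuous.continuousOn).closure
    rw [Set.image_univ, f.toImage.denseRange.closure_range] at h
    exact ⟨h⟩
  have : IrreducibleSpace f.image := ⟨Nonempty.map f.toImage inferInstance⟩
  exact isIntegral_of_irreducibleSpace_of_isReduced _

/-- Let `ι : N ⟶ P` be an open immersion and `e : N ⟶ Y` a morphism over `Q`. If `p : X ⟶ P` and
`π : X ⟶ Y` are `Q`-morphisms which are induced by a common morphism to `N` over a dense part of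
`X`, then they are so over any open subset over which `p` factors through `ι`. -/
theorem comp_eq_comp_of_isDominant {X P Y Q N U : Scheme.{0}} [IsReduced X] {u : U ⟶ X}
    [IsDominant u] {ι : N ⟶ P} [Mono ι] {e : N ⟶ Y} {f : P ⟶ Q} {y : Y ⟶ Q} [IsSeparated y]
    (he : ι ≫ f = e ≫ y) {p : X ⟶ P} {π : X ⟶ Y} (hp : p ≫ f = π ≫ y) {m : U ⟶ N}
    (hmι : u ≫ p = m ≫ ι) (hme : u ≫ π = m ≫ e) {W : X.Opens} {q : W.toScheme ⟶ N}
    (hq : q ≫ ι = W.ι ≫ p) : q ≫ e = W.ι ≫ π := by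
  have : IsDominant (u ∣_ W) := IsZariskiLocalAtTarget.restrict ‹_› W
  refine ext_of_isDominant_of_isSeparated y ?_ (u ∣_ W) ?_
  · rw [Category.assoc, ← he, reassoc_of% hq, hp, Category.assoc]
  · have h : (u ∣_ W) ≫ q = (u ⁻¹ᵁ W).ι ≫ m := by
      rw [← cancel_mono ι, Category.assoc, hq, morphismRestrict_ι_assoc, hmι, Category.assoc]
    rw [reassoc_of% h, morphismRestrict_ι_assoc, hme]

theorem comp_eq_comp_of_forall_comp_eq {n : Type} {X P T : Scheme.{0}} {Y N : n → Scheme.{0}}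
    {p : X ⟶ P} {π : ∀ i, X ⟶ Y i} {ι : ∀ i, N i ⟶ P} {e : ∀ i, N i ⟶ Y i}
    [∀ i, IsOpenImmersion (e i)] {q : ∀ i, (π i ⁻¹ᵁ (e i).opensRange).toScheme ⟶ N i}
    (hqe : ∀ i, q i ≫ e i = Scheme.Opens.ι _ ≫ π i) (hqι : ∀ i, q i ≫ ι i = Scheme.Opens.ι _ ≫ p)
    (hcov : ∀ x, ∃ i, π i x ∈ (e i).opensRange) {a b : T ⟶ X} (hab : ∀ i, a ≫ π i = b ≫ π i) :
    a ≫ p = b ≫ p := by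
  let O (i) : T.Opens := (a ≫ π i) ⁻¹ᵁ (e i).opensRange
  have hO : TopologicalSpace.IsOpenCover O := by
    refine eq_top_iff.mpr fun t _ ↦ TopologicalSpace.Opens.mem_iSup.mpr ?_
    obtain ⟨i, hi⟩ := hcov (a t)
    exact ⟨i, by simpa [O] using hi⟩
  refine (T.openCoverOfIsOpenCover O hO).hom_ext _ _ fun (i : n) ↦ ?_
  change (O i).ι ≫ a ≫ p = (O i).ι ≫ b ≫ p
  have key (c : T ⟶ X) (hc : a ≫ π i = c ≫ π i) : ∃ r : (O i).toScheme ⟶ N i,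
      r ≫ e i = (O i).ι ≫ a ≫ π i ∧ r ≫ ι i = (O i).ι ≫ c ≫ p := by
    let l : (O i).toScheme ⟶ (π i ⁻¹ᵁ (e i).opensRange).toScheme :=
      IsOpenImmersion.lift (Scheme.Opens.ι _) ((O i).ι ≫ c) (by
        rw [Scheme.Opens.range_ι]
        rintro _ ⟨t, rfl⟩
        have ht : (a ≫ π i) t.1 ∈ (e i).opensRange := t.2
        rw [hc] at ht
        exact ht)
    have hl : l ≫ Scheme.Opens.ι _ = (O i).ι ≫ c := IsOpenImmersion.lift_fac ..
    exact ⟨l ≫ q i, by rw [Category.assoc, hqe, reassoc_of% hl, hc],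
      by rw [Category.assoc, hqι, reassoc_of% hl]⟩
  obtain ⟨r, hr, hr'⟩ := key a rfl
  obtain ⟨s, hs, hs'⟩ := key b (hab i)
  rw [← hr', ← hs', (cancel_mono (e i)).mp (hr.trans hs.symm)]

theorem exists_finite_isAffineOpen_cover {P Q : Scheme.{0}} [CompactSpace P] (f : P ⟶ Q) :
    ∃ (n : Type) (_ : Finite n) (U : n → P.Opens) (W : n → Q.Opens),
      (∀ i, IsAffineOpen (U i)) ∧ (∀ i, IsAffineOpen (W i)) ∧ (∀ i, U i ≤ f ⁻¹ᵁ W i) ∧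
      (∀ i, (U i : Set P).Nonempty) ∧ ∀ x, ∃ i, x ∈ U i := by
  have key (x : P) : ∃ (U : P.Opens) (W : Q.Opens), IsAffineOpen U ∧ IsAffineOpen W ∧
      U ≤ f ⁻¹ᵁ W ∧ x ∈ U := by
    obtain ⟨_, ⟨W, hW, rfl⟩, hxW, -⟩ :=
      Q.isBasis_affineOpens.exists_subset_of_mem_open (Set.mem_univ (f x)) isOpen_univ
    obtain ⟨_, ⟨U, hU, rfl⟩, hxU, hUW⟩ :=
      P.isBasis_affineOpens.exists_subset_of_mem_open (show x ∈ f ⁻¹ᵁ W from hxW) (f ⁻¹ᵁ W).isOpen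
    exact ⟨U, W, hU, hW, hUW, hxU⟩
  choose U W hU hW hUW hx using key
  obtain ⟨t, ht⟩ := isCompact_univ.elim_nhds_subcover (fun x ↦ (U x : Set P))
    fun x _ ↦ (U x).isOpen.mem_nhds (hx x)
  refine ⟨t, inferInstance, fun i ↦ U i, fun i ↦ W i, fun i ↦ hU i, fun i ↦ hW i, fun i ↦ hUW i,
    fun i ↦ ⟨i, hx i⟩, fun x ↦ ?_⟩
  simpa using ht.2 (Set.mem_univ x)

theorem isNoetherian_opens {X : Scheme.{0}} [IsNoetherian X] (U : X.Opens) :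
    IsNoetherian U.toScheme where
  isCompact_univ :=
    (isCompact_iff_compactSpace.mp (TopologicalSpace.NoetherianSpace.isCompact U.1)).isCompact_univ

/-- A form of Chow's lemma: a proper morphism from an integral scheme to an open subscheme `Q'` of
`Q` is dominated over `Q'` by a proper morphism to `Q`, through which it factors generically. -/
theorem exists_isProper_factorization {P Q' Q : Scheme.{0}} [IsIntegral P] [IsNoetherian P]
    (g : P ⟶ Q') [IsProper g] (j : Q' ⟶ Q) [IsOpenImmersion j] [QuasiCompact j] :
    ∃ (V : Scheme.{0}) (δ : V ⟶ Q) (U : P.Opens) (s : U.toScheme ⟶ V), IsProper δ ∧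
      genericPoint P ∈ U ∧ s ≫ δ = U.ι ≫ g ≫ j ∧
      ∃ k : pullback δ j ⟶ P, k ≫ g = pullback.snd δ j := by
  obtain ⟨n, _, N, W, hN, hW, hNW, hne, hcov⟩ := exists_finite_isAffineOpen_cover (g ≫ j)
  have : ∀ i, IsNoetherian (N i).toScheme := fun i ↦ isNoetherian_opens _
  have : ∀ i, IsAffine (N i).toScheme := hN
  choose Y e y he hy hey using fun i ↦
    exists_isOpenImmersion_isProper_of_isAffine ((N i).ι ≫ g ≫ j) (hW i) (by
      rintro _ ⟨x, rfl⟩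
      exact hNW i x.2)
  obtain ⟨Y₀, y₀, π₀, hy₀, hπ₀, H⟩ := exists_isProper_lift_of_finite Y y hy
  let U : P.Opens := ⟨⋂ i, N i, isOpen_iInter_of_finite fun i ↦ (N i).isOpen⟩
  have hU (i) : U ≤ N i := Set.iInter_subset _ i
  have hgen : genericPoint P ∈ U := Set.mem_iInter.mpr fun i ↦
    ((genericPoint_spec P).mem_open_set_iff (N i).isOpen).mpr (by simpa using hne i)
  have := isNoetherian_opens U
  have : Nonempty U.toScheme := ⟨⟨_, hgen⟩⟩
  obtain ⟨l, hl, hlπ⟩ := H U (U.ι ≫ g ≫ j) (fun i ↦ P.homOfLE (hU i) ≫ e i) (by simp [hey])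
  let r : U.toScheme ⟶ pullback (g ≫ j) y₀ := pullback.lift U.ι l hl.symm
  let X := r.image
  have : IsIntegral X := isIntegral_image r
  let u : U.toScheme ⟶ X := r.toImage
  let p : X ⟶ P := r.imageι ≫ pullback.fst _ _
  let π : X ⟶ Y₀ := r.imageι ≫ pullback.snd _ _
  have hp : p ≫ g ≫ j = π ≫ y₀ := by simp [p, π, pullback.condition]
  have hup : u ≫ p = U.ι := by
    simp only [u, p, r, Scheme.Hom.toImage_imageι_assoc, pullback.lift_fst]
  have huπ : u ≫ π = l := by
    simp only [u, π, r, Scheme.Hom.toImage_imageι_assoc, pullback.lift_snd]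
  have hmι (i) : u ≫ p = P.homOfLE (hU i) ≫ (N i).ι := by simp [hup]
  have hme (i) : u ≫ π ≫ π₀ i = P.homOfLE (hU i) ≫ e i := by rw [reassoc_of% huπ, hlπ]
  have hpi (i) : p ≫ g ≫ j = (π ≫ π₀ i) ≫ y i :=
    (hp.trans congr(π ≫ $((hπ₀ i).symm))).trans (Category.assoc ..).symm
  have hcovX (x) : ∃ i, (π ≫ π₀ i) x ∈ (e i).opensRange := by
    obtain ⟨i, hi⟩ := hcov (p x)
    let q : (p ⁻¹ᵁ N i).toScheme ⟶ (N i).toScheme := p ∣_ N i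
    have := comp_eq_comp_of_isDominant (hey i).symm (hpi i) (hmι i) (hme i)
      (q := q) (morphismRestrict_ι _ _)
    exact ⟨i, q ⟨x, hi⟩, congr($this ⟨x, hi⟩)⟩
  let q (i) : ((π ≫ π₀ i) ⁻¹ᵁ (e i).opensRange).toScheme ⟶ (N i).toScheme :=
    IsOpenImmersion.lift (e i) (Scheme.Opens.ι _ ≫ π ≫ π₀ i) (by
      rintro _ ⟨x, rfl⟩
      exact x.2)
  have hqe (i) : q i ≫ e i = Scheme.Opens.ι _ ≫ π ≫ π₀ i := IsOpenImmersion.lift_fac ..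
  have hqι (i) : q i ≫ (N i).ι = Scheme.Opens.ι _ ≫ p :=
    comp_eq_comp_of_isDominant (hey i) (hpi i).symm (hme i) (hmι i) (hqe i)
  let c : X ⟶ pullback y₀ j := pullback.lift π (p ≫ g) (by simp [hp])
  have : Mono c := by
    refine ⟨fun a b hab ↦ ?_⟩
    have habπ : a ≫ π = b ≫ π := by
      simpa only [c, Category.assoc, pullback.lift_fst] using congr($hab ≫ pullback.fst _ _)
    have habp : a ≫ p = b ≫ p :=
      comp_eq_comp_of_forall_comp_eq hqe hqι hcovX fun i ↦ by simp [reassoc_of% habπ]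
    rw [← cancel_mono r.imageι]
    apply pullback.hom_ext <;> simpa [π, p] using ‹_›
  have : IsProper (c ≫ pullback.snd _ _) := by
    rw [pullback.lift_snd]
    infer_instance
  have : IsProper c := .of_comp c (pullback.snd _ _)
  have : IsClosedImmersion c := (IsClosedImmersion.iff_isProper_and_mono _).mpr ⟨‹_›, ‹_›⟩
  let δ := π.imageι ≫ y₀
  let v : X ⟶ pullback δ j := pullback.lift π.toImage (p ≫ g) (by simp [δ, hp])
  let d : pullback δ j ⟶ pullback y₀ j :=
    pullback.lift (pullback.fst _ _ ≫ π.imageι) (pullback.snd _ _) (by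
      simp [δ, ← pullback.condition])
  have hvd : v ≫ d = c := by
    apply pullback.hom_ext
    · rw [Category.assoc, pullback.lift_fst, pullback.lift_fst_assoc, pullback.lift_fst,
        Scheme.Hom.toImage_imageι]
    · rw [Category.assoc, pullback.lift_snd, pullback.lift_snd, pullback.lift_snd]
  have : IsClosedImmersion (v ≫ d) := hvd ▸ ‹_›
  have : IsSeparated (d ≫ pullback.snd _ _) := by
    rw [pullback.lift_snd]
    infer_instance
  have : IsSeparated d := .of_comp d (pullback.snd _ _)
  have : IsClosedImmersion v := .of_comp v d
  have : IsDominant (v ≫ pullback.fst _ _) := by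
    rw [pullback.lift_fst]
    infer_instance
  have : IsDominant v := .of_comp_of_isOpenImmersion v (pullback.fst _ _)
  have : Surjective v :=
    surjective_of_isDominant_of_isClosed_range v v.isClosedEmbedding.isClosed_range
  have := isReduced_image π
  have : IsReduced (pullback δ j) := isReduced_of_isOpenImmersion (pullback.fst δ j)
  have : IsIso v := isIso_of_isClosedImmersion_of_surjective v
  refine ⟨π.image, δ, U, u ≫ π.toImage, inferInstance, hgen, ?_, inv v ≫ p, ?_⟩
  · simp [δ, reassoc_of% huπ, hl]
  · rw [Category.assoc, IsIso.inv_comp_eq, pullback.lift_snd]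

theorem isIso_residueFieldMap_of_surjective {X Y : Scheme.{0}} (f : X ⟶ Y) (x : X)
    (h : Function.Surjective (f.residueFieldMap x)) : IsIso (f.residueFieldMap x) :=
  (ConcreteCategory.isIso_iff_bijective _).mpr ⟨(f.residueFieldMap x).hom.injective, h⟩

theorem isIso_residueFieldMap_of_isPreimmersion {X Y : Scheme.{0}} (f : X ⟶ Y) [IsPreimmersion f]
    (x : X) : IsIso (f.residueFieldMap x) := by
  refine isIso_residueFieldMap_of_surjective f x fun b ↦ ?_
  obtain ⟨b, rfl⟩ := X.residue_surjective x b
  obtain ⟨b, rfl⟩ := f.stalkMap_surjective x b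
  exact ⟨Y.residue _ b, congr($(Scheme.residue_residueFieldMap f x) b)⟩

theorem isIso_residueFieldMap_of_comp {X Y Z : Scheme.{0}} (f : X ⟶ Y) (g : Y ⟶ Z) (x : X)
    [h : IsIso ((f ≫ g).residueFieldMap x)] : IsIso (g.residueFieldMap (f x)) := by
  have h : IsIso (g.residueFieldMap (f x) ≫ f.residueFieldMap x) := by
    rwa [← Scheme.residueFieldMap_comp]
  have h' : Function.Surjective (g.residueFieldMap (f x) ≫ f.residueFieldMap x) :=
    ((ConcreteCategory.isIso_iff_bijective _).mp h).surjective
  have : IsIso (f.residueFieldMap x) := isIso_residueFieldMap_of_surjective f x fun b ↦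
    (h' b).imp' _ fun _ hb ↦ hb
  exact IsIso.of_isIso_comp_right _ (f.residueFieldMap x)

/-- A lift of the generic point of a subscheme `Z` of `Q` to `V` spreads out to an open subset of
`Z`. -/
theorem exists_opens_isIso_residueFieldMap {Z Q V : Scheme.{0}} [IsIntegral Z] (i : Z ⟶ Q)
    [IsPreimmersion i] (δ : V ⟶ Q) [LocallyOfFiniteType δ]
    (t : Spec (Q.residueField (i (genericPoint Z))) ⟶ V)
    (ht : t ≫ δ = Q.fromSpecResidueField _) :
    ∃ O : Z.Opens, genericPoint Z ∈ O ∧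
      ∀ u ∈ O, ∃ z, δ z = i u ∧ IsIso (δ.residueFieldMap z) := by
  have : IsIso (Z.residue (genericPoint Z)) :=
    (ConcreteCategory.isIso_iff_bijective _).mpr
      ⟨RingHom.injective (R := Z.functionField) (Z.residue (genericPoint Z)).hom,
        Z.residue_surjective _⟩
  obtain ⟨O, hO, f, -, hf⟩ := spread_out_of_isGermInjective' i δ (x := genericPoint Z)
    (inv (Spec.map (Z.residue (genericPoint Z))) ≫
      Spec.map (i.residueFieldMap (genericPoint Z)) ≫ t) (by
      rw [Category.assoc, Category.assoc, ht, IsIso.inv_comp_eq,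
        Scheme.Hom.SpecMap_residueFieldMap_fromSpecResidueField]
      rfl)
  refine ⟨O, hO, fun u hu ↦ ⟨f ⟨u, hu⟩, congr($hf ⟨u, hu⟩), ?_⟩⟩
  have : IsIso ((f ≫ δ).residueFieldMap ⟨u, hu⟩) := by
    rw [hf]
    exact isIso_residueFieldMap_of_isPreimmersion _ _
  exact isIso_residueFieldMap_of_comp f δ _

/-- The closure of a point, with its reduced structure. -/
theorem exists_isClosedImmersion_genericPoint_eq {X : Scheme.{0}} [IsLocallyNoetherian X] (x : X) :
    ∃ (Z : Scheme.{0}) (i : Z ⟶ X) (s : Spec (X.residueField x) ⟶ Z) (_ : IsIntegral Z),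
      IsClosedImmersion i ∧ s ≫ i = X.fromSpecResidueField x ∧
      (∀ y, s y = genericPoint Z) ∧ i (genericPoint Z) = x := by
  let f := X.fromSpecResidueField x
  have hint := isIntegral_image f
  have hs (y) : f.toImage y = genericPoint f.image := by
    have hy : IsGenericPoint y Set.univ := by
      rw [isGenericPoint_iff_specializes]
      intro z
      simp [Subsingleton.elim y z]
    have := hy.image f.toImage.continuous
    rw [Set.image_univ, f.toImage.denseRange.closure_range] at this
    exact this.eq (genericPoint_spec _)
  refine ⟨f.image, f.imageι, f.toImage, hint, inferInstance, f.toImage_imageι, hs, ?_⟩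
  obtain ⟨y⟩ : Nonempty (Spec (X.residueField x)) := inferInstance
  rw [← hs y, ← Scheme.Hom.comp_apply, f.toImage_imageι]
  exact Scheme.fromSpecResidueField_apply x y

theorem isNoetherian_of_locallyOfFiniteType {X Y : Scheme.{0}} (f : X ⟶ Y) [LocallyOfFiniteType f]
    [QuasiCompact f] [IsNoetherian Y] : IsNoetherian X :=
  have := LocallyOfFiniteType.isLocallyNoetherian f
  have := QuasiCompact.compactSpace_of_compactSpace f
  { }

theorem exists_comp_fromSpecResidueField_comp_eq {X Y : Scheme.{0}} (f : X ⟶ Y) (x : X)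
    [IsIso (f.residueFieldMap x)] :
    ∃ l : Spec (Y.residueField (f x)) ⟶ Spec (X.residueField x),
      l ≫ X.fromSpecResidueField x ≫ f = Y.fromSpecResidueField (f x) :=
  ⟨inv (Spec.map (f.residueFieldMap x)), by
    rw [IsIso.inv_comp_eq, Scheme.Hom.SpecMap_residueFieldMap_fromSpecResidueField]⟩

/-- A finite family of proper morphisms to `Q` covering the set `Z`, completely decomposed over `Z`
if `cd` holds, each of whose members restricts over `Q'` to a morphism that factors through the
family `σ` or has empty source. -/
def HasExtendedCovering (cd : Prop) {Q' Q : Scheme.{0}} (j : Q' ⟶ Q) {A : Type}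
    {P : A → Scheme.{0}} (σ : ∀ a, P a ⟶ Q') (Z : Set Q) : Prop :=
  ∃ (B : Type) (_ : Finite B) (V : B → Scheme.{0}) (δ : ∀ β, V β ⟶ Q),
    (∀ β, IsProper (δ β)) ∧
    (∀ u ∈ Z, ∃ (β : B) (z : V β), δ β z = u ∧ (cd → IsIso ((δ β).residueFieldMap z))) ∧
    ∀ β, (∃ (a : A) (k : pullback (δ β) j ⟶ P a), k ≫ σ a = pullback.snd (δ β) j) ∨
      IsEmpty (pullback (δ β) j : Scheme)

namespace HasExtendedCovering

variable {cd : Prop} {Q' Q : Scheme.{0}} {j : Q' ⟶ Q} {A : Type} {P : A → Scheme.{0}}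
  {σ : ∀ a, P a ⟶ Q'} {Z Z' : Set Q}

theorem empty : HasExtendedCovering cd j σ ∅ :=
  ⟨Empty, inferInstance, Empty.rec, fun β ↦ β.rec, fun β ↦ β.rec, by simp, fun β ↦ β.rec⟩

theorem mono (h : HasExtendedCovering cd j σ Z) (hZ : Z' ⊆ Z) :
    HasExtendedCovering cd j σ Z' := by
  obtain ⟨B, hB, V, δ, h₁, h₂, h₃⟩ := h
  exact ⟨B, hB, V, δ, h₁, fun u hu ↦ h₂ u (hZ hu), h₃⟩

theorem union (h : HasExtendedCovering cd j σ Z) (h' : HasExtendedCovering cd j σ Z') :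
    HasExtendedCovering cd j σ (Z ∪ Z') := by
  obtain ⟨B, hB, V, δ, h₁, h₂, h₃⟩ := h
  obtain ⟨B', hB', V', δ', h₁', h₂', h₃'⟩ := h'
  refine ⟨B ⊕ B', inferInstance, Sum.elim V V', Sum.rec δ δ', Sum.rec h₁ h₁', ?_, Sum.rec h₃ h₃'⟩
  rintro u (hu | hu)
  · obtain ⟨β, z, h⟩ := h₂ u hu
    exact ⟨.inl β, z, h⟩
  · obtain ⟨β, z, h⟩ := h₂' u hu
    exact ⟨.inr β, z, h⟩

theorem of_isProper {V : Scheme.{0}} (δ : V ⟶ Q) [IsProper δ]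
    (hZ : ∀ u ∈ Z, ∃ z : V, δ z = u ∧ (cd → IsIso (δ.residueFieldMap z)))
    (hδ : (∃ (a : A) (k : pullback δ j ⟶ P a), k ≫ σ a = pullback.snd δ j) ∨
      IsEmpty (pullback δ j : Scheme)) :
    HasExtendedCovering cd j σ Z :=
  ⟨Unit, inferInstance, fun _ ↦ V, fun _ ↦ δ, fun _ ↦ inferInstance,
    fun u hu ↦ ⟨(), hZ u hu⟩, fun _ ↦ hδ⟩

/-- Every irreducible closed subset is covered outside a smaller closed subset. -/
theorem exists_diff [IsNoetherian Q] [IsOpenImmersion j] [∀ a, IsProper (σ a)]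
    [∀ a, IsNoetherian (P a)]
    (hσ : ∀ u : Q', ∃ (a : A) (v : P a), σ a v = u ∧ (cd → IsIso ((σ a).residueFieldMap v)))
    (η : Q) : ∃ Z₀ : Set Q, IsClosed Z₀ ∧ η ∉ Z₀ ∧
      HasExtendedCovering cd j σ (closure {η} \ Z₀) := by
  obtain ⟨Z, i, -, _, _, -, -, hη⟩ := exists_isClosedImmersion_genericPoint_eq η
  have hi : Set.range i = closure {η} := by
    rw [← hη, ← Set.image_singleton, i.isClosedEmbedding.closure_image_eq, genericPoint_closure,
      Set.image_univ]
  by_cases hηj : η ∈ Set.range j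
  swap
  · refine ⟨∅, isClosed_empty, by simp, of_isProper i ?_ (.inr ⟨fun w ↦ hηj ?_⟩)⟩
    · rw [Set.sdiff_empty, ← hi]
      rintro _ ⟨z, rfl⟩
      exact ⟨z, rfl, fun _ ↦ isIso_residueFieldMap_of_isPreimmersion i z⟩
    · have h : i (pullback.fst i j w) = j (pullback.snd i j w) := by
        rw [← Scheme.Hom.comp_apply, pullback.condition, Scheme.Hom.comp_apply]
      have hmem : i (pullback.fst i j w) ∈ closure {η} := hi ▸ Set.mem_range_self _
      exact (specializes_iff_mem_closure.mpr hmem).mem_open j.isOpenEmbedding.isOpen_range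
        (h ▸ Set.mem_range_self _)
  obtain ⟨η', rfl⟩ := hηj
  obtain ⟨a, v, rfl, hcd⟩ := hσ η'
  obtain ⟨P', i', s', _, _, hsi', hs', -⟩ := exists_isClosedImmersion_genericPoint_eq v
  have : IsNoetherian P' := isNoetherian_of_locallyOfFiniteType i'
  obtain ⟨V, δ, U, r, _, hU, hr, k, hk⟩ := exists_isProper_factorization (i' ≫ σ a) j
  have hs'U : Set.range s' ⊆ Set.range U.ι := by
    rintro _ ⟨y, rfl⟩
    simpa [hs' y] using hU
  let t := IsOpenImmersion.lift U.ι s' hs'U ≫ r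
  have ht : t ≫ δ = (P a).fromSpecResidueField v ≫ σ a ≫ j := by
    rw [Category.assoc, hr, IsOpenImmersion.lift_fac_assoc, Category.assoc, reassoc_of% hsi']
  have hfac : ∃ (a : A) (k : pullback δ j ⟶ P a), k ≫ σ a = pullback.snd δ j :=
    ⟨a, k ≫ i', by rw [Category.assoc, hk]⟩
  by_cases hd : cd
  swap
  · refine ⟨∅, isClosed_empty, by simp, of_isProper δ (fun u hu ↦ ?_) (.inl hfac)⟩
    have hu' : u ∈ Set.range δ := by
      rw [Set.sdiff_empty] at hu
      refine δ.isClosedMap.isClosed_range.closure_subset_iff.mpr ?_ hu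
      obtain ⟨y⟩ : Nonempty (Spec ((P a).residueField v)) := inferInstance
      refine Set.singleton_subset_iff.mpr ⟨t y, ?_⟩
      rw [← Scheme.Hom.comp_apply, ht]
      simp
    obtain ⟨z, hz⟩ := hu'
    exact ⟨z, hz, fun h ↦ (hd h).elim⟩
  have hiso : IsIso ((σ a ≫ j).residueFieldMap v) := by
    rw [Scheme.residueFieldMap_comp]
    exact IsIso.comp_isIso' (isIso_residueFieldMap_of_isPreimmersion j (σ a v)) (hcd hd)
  obtain ⟨t', ht'⟩ : ∃ t' : Spec (Q.residueField (j (σ a v))) ⟶ V,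
      t' ≫ δ = Q.fromSpecResidueField (j (σ a v)) := by
    obtain ⟨l, hl⟩ := exists_comp_fromSpecResidueField_comp_eq (σ a ≫ j) v
    have h : (l ≫ t) ≫ δ = Q.fromSpecResidueField ((σ a ≫ j) v) := by
      rw [Category.assoc, ht, hl]
    exact ⟨l ≫ t, h⟩
  obtain ⟨O, hO, h⟩ := exists_opens_isIso_residueFieldMap i δ
    (Spec.map (Q.residueFieldCongr hη.symm).hom ≫ t')
    (by rw [Category.assoc, ht', Scheme.residueFieldCongr_fromSpecResidueField])
  refine ⟨i '' Oᶜ, i.isClosedEmbedding.isClosedMap _ O.isOpen.isClosed_compl, ?_, ?_⟩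
  · rintro ⟨z, hz, hz'⟩
    rw [← hη] at hz'
    exact hz (i.isClosedEmbedding.injective hz' ▸ hO)
  · refine of_isProper δ (fun u hu ↦ ?_) (.inl hfac)
    rw [← hi] at hu
    obtain ⟨⟨z, rfl⟩, hz⟩ := hu
    obtain ⟨y, hy, hy'⟩ := h z (by_contra fun hz' ↦ hz ⟨z, hz', rfl⟩)
    exact ⟨y, hy, fun _ ↦ hy'⟩

theorem of_isClosed [IsNoetherian Q] [IsOpenImmersion j] [∀ a, IsProper (σ a)]
    [∀ a, IsNoetherian (P a)]
    (hσ : ∀ u : Q', ∃ (a : A) (v : P a), σ a v = u ∧ (cd → IsIso ((σ a).residueFieldMap v)))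
    (Z : TopologicalSpace.Closeds Q) : HasExtendedCovering cd j σ (Z : Set Q) := by
  induction Z using WellFoundedLT.induction with | ind Z ih => ?_
  by_cases hZ : IsIrreducible (Z : Set Q)
  · obtain ⟨Z₀, hZ₀, hη, h⟩ := exists_diff (j := j) hσ hZ.genericPoint
    rw [hZ.genericPoint_closure_eq, Z.isClosed.closure_eq] at h
    refine (h.union (ih (Z ⊓ ⟨Z₀, hZ₀⟩) (inf_lt_left.mpr fun hle ↦ hη (hle ?_)))).mono ?_
    · have := hZ.isGenericPoint_genericPoint_closure.mem
      rwa [Z.isClosed.closure_eq] at this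
    · intro u hu
      by_cases hu' : u ∈ Z₀
      exacts [.inr ⟨hu, hu'⟩, .inl ⟨hu, hu'⟩]
  rcases Set.eq_empty_or_nonempty (Z : Set Q) with hZ' | hZ'
  · exact hZ' ▸ empty
  have hZ'' : ¬ IsPreirreducible (Z : Set Q) := fun h ↦ hZ ⟨hZ', h⟩
  rw [isPreirreducible_iff_isClosed_union_isClosed] at hZ''
  simp only [not_forall, not_or, exists_prop] at hZ''
  obtain ⟨Z₁, Z₂, h₁, h₂, hZ₁₂, hZ₁, hZ₂⟩ := hZ''
  refine ((ih (Z ⊓ ⟨Z₁, h₁⟩) (inf_lt_left.mpr hZ₁)).union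
    (ih (Z ⊓ ⟨Z₂, h₂⟩) (inf_lt_left.mpr hZ₂))).mono fun u hu ↦ ?_
  exact (hZ₁₂ hu).imp (fun h ↦ ⟨hu, h⟩) (fun h ↦ ⟨hu, h⟩)

end HasExtendedCovering

theorem statement15
    (S T : Scheme.{0}) [IsNoetherian S] [IsNoetherian T] [S.IsSeparated] [T.IsSeparated]
    (j : S ⟶ T) [IsOpenImmersion j]
    (Q : Scheme.{0}) (q : Q ⟶ T) [IsProper q]
    -- `Q' = Q ×_T S`, with projections `j' : Q' ⟶ Q` and `q' : Q' ⟶ S`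
    (Q' : Scheme.{0}) (j' : Q' ⟶ Q) (q' : Q' ⟶ S)
    (hpb : IsPullback j' q' q j)
    -- a finite family of proper `S`-schemes over `Q'` consisting of proper morphisms ...
    (A : Type) [Finite A] (P : A → Scheme.{0}) (p : ∀ a, P a ⟶ S) [∀ a, IsProper (p a)]
    (σ : ∀ a, P a ⟶ Q') (hσ : ∀ a, σ a ≫ q' = p a)
    (hproper : ∀ a, IsProper (σ a))
    -- ... which is jointly surjective (i.e. at least a proper covering family)
    (hsurj : ∀ u : Q', ∃ (a : A) (v : P a), (σ a).base v = u) :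
    -- proper covering case: there is a proper covering family `δ` over `Q` such that each
    -- base change `V_β ×_Q Q' ⟶ Q'` factors through some `σ_α` or has empty source
    (∃ (B : Type) (_ : Finite B) (V : B → Scheme.{0}) (v : ∀ β, V β ⟶ T)
        (δ : ∀ β, V β ⟶ Q),
      (∀ β, IsProper (v β)) ∧ (∀ β, δ β ≫ q = v β) ∧ (∀ β, IsProper (δ β)) ∧
      (∀ u : Q, ∃ (β : B) (z : V β), (δ β).base z = u) ∧
      (∀ β, (∃ (a : A) (k : pullback (δ β) j' ⟶ P a), k ≫ σ a = pullback.snd (δ β) j')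
        ∨ IsEmpty (pullback (δ β) j' : Scheme))) ∧
    -- cdp-covering case: if the given family is moreover completely decomposed, the family
    -- `δ` can be chosen completely decomposed as well
    ((∀ u : Q', ∃ (a : A) (v : P a), (σ a).base v = u ∧ IsIso ((σ a).residueFieldMap v)) →
      ∃ (B : Type) (_ : Finite B) (V : B → Scheme.{0}) (v : ∀ β, V β ⟶ T)
          (δ : ∀ β, V β ⟶ Q),
        (∀ β, IsProper (v β)) ∧ (∀ β, δ β ≫ q = v β) ∧ (∀ β, IsProper (δ β)) ∧
        (∀ u : Q, ∃ (β : B) (z : V β), (δ β).base z = u) ∧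
        (∀ u : Q, ∃ (β : B) (z : V β), (δ β).base z = u ∧ IsIso ((δ β).residueFieldMap z)) ∧
        (∀ β, (∃ (a : A) (k : pullback (δ β) j' ⟶ P a), k ≫ σ a = pullback.snd (δ β) j')
          ∨ IsEmpty (pullback (δ β) j' : Scheme))) := by
  have : IsOpenImmersion j' := MorphismProperty.of_isPullback hpb.flip ‹IsOpenImmersion j›
  have := isNoetherian_of_locallyOfFiniteType q
  have := fun a ↦ isNoetherian_of_locallyOfFiniteType (p a)
  constructor
  · obtain ⟨B, hB, V, δ, h₁, h₂, h₃⟩ :=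
      HasExtendedCovering.of_isClosed (cd := False) (j := j') (σ := σ)
        (fun u ↦ (hsurj u).imp fun a ↦ .imp fun v h ↦ ⟨h, False.elim⟩) ⊤
    exact ⟨B, hB, V, fun β ↦ δ β ≫ q, δ, fun β ↦ inferInstance, fun β ↦ rfl, h₁,
      fun u ↦ (h₂ u trivial).imp fun β ↦ .imp fun z ↦ And.left, h₃⟩
  · intro hcd
    obtain ⟨B, hB, V, δ, h₁, h₂, h₃⟩ :=
      HasExtendedCovering.of_isClosed (cd := True) (j := j') (σ := σ)
        (fun u ↦ (hcd u).imp fun a ↦ .imp fun v h ↦ ⟨h.1, fun _ ↦ h.2⟩) ⊤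
    exact ⟨B, hB, V, fun β ↦ δ β ≫ q, δ, fun β ↦ inferInstance, fun β ↦ rfl, h₁,
      fun u ↦ (h₂ u trivial).imp fun β ↦ .imp fun z ↦ And.left,
      fun u ↦ (h₂ u trivial).imp fun β ↦ .imp fun z h ↦ ⟨h.1, h.2 trivial⟩, h₃⟩
end
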